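/- In the two-sided Lanczos tridiagonalization, assuming v_1,...,v_k and u_1,...,u_k are orthonormal and all recurrences A'u_i = β_i v_{i+1} + α_i v_i + γ_{i-1} v_{i-1} hold for i ≤ k−1, then for every i ≤ k−2, u_{k+1}'u_i = 0, where u_{k+1} = (Av_k − α_k u_k − β_{k-1}u_{k-1})/γ_k with γ_k ≠ 0. -/

import Mathlib

open Matrix

/-- Induction step for the tridiagonalization: u_{k+1}'u_i = 0 for i ≤ k−2. -/
theorem stmt9 (n : ℕ) (A : Matrix (Fin n) (Fin n) ℝ)
    (u v : ℕ → (Fin n → ℝ)) (α β γ : ℕ → ℝ) (k : ℕ) (hk : 1 ≤ k)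
    (hγ0 : γ 0 = 0) (hv0 : v 0 = 0)
    (hγ : γ k ≠ 0)
    (hu : u (k + 1) = (γ k)⁻¹ • (A *ᵥ v k - α k • u k - β (k - 1) • u (k - 1)))
    (hrec : ∀ i, 1 ≤ i → i ≤ k - 1 →
      Aᵀ *ᵥ u i = β i • v (i + 1) + α i • v i + γ (i - 1) • v (i - 1))
    (horthu : ∀ i j, 1 ≤ i → i ≤ k → 1 ≤ j → j ≤ k →
      u i ⬝ᵥ u j = if i = j then 1 else 0)
    (horthv : ∀ i j, 1 ≤ i → i ≤ k → 1 ≤ j → j ≤ k →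
      v i ⬝ᵥ v j = if i = j then 1 else 0) :
    ∀ i, 1 ≤ i → i ≤ k - 2 → u (k + 1) ⬝ᵥ u i = 0 := by
  intro i hi hik
  have huk : u k ⬝ᵥ u i = 0 := by
    rw [horthu k i hk le_rfl hi (by omega), if_neg (by omega)]
  have huk' : u (k - 1) ⬝ᵥ u i = 0 := by
    rw [horthu (k - 1) i (by omega) (by omega) hi (by omega), if_neg (by omega)]
  have hv : ∀ j, j < k → v k ⬝ᵥ v j = 0 := by
    intro j hj
    rcases Nat.eq_zero_or_pos j with rfl | hj0
    · rw [hv0, dotProduct_zero]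
    · rw [horthv k j hk le_rfl hj0 hj.le, if_neg hj.ne']
  have hA : (A *ᵥ v k) ⬝ᵥ u i = 0 := by
    rw [dotProduct_comm, dotProduct_mulVec, ← mulVec_transpose, dotProduct_comm,
      hrec i hi (by omega)]
    simp only [dotProduct_add, dotProduct_smul, hv (i + 1) (by omega), hv i (by omega),
      hv (i - 1) (by omega), smul_zero, add_zero]
  simp only [hu, smul_dotProduct, sub_dotProduct, hA, huk, huk', smul_zero, sub_zero]
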